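/- Let w be an Oleinik solution on [0,X]. For any 0 < ε < X there exist δ ∈ (0,δ₁] and a constant C > 0, independent of ψ, such that |∂ₓ w(x,ψ)| ≤ C ψ for all (x,ψ) ∈ [ε,X]×[0,δ]. -/

import Mathlib

open Set

/-- Iterated partial derivative `∂ₓ^k ∂_ψ^m w` of a function of two real variables. -/
noncomputable def pd (k m : ℕ) (w : ℝ → ℝ → ℝ) (x ψ : ℝ) : ℝ :=
  iteratedDeriv k (fun x' => iteratedDeriv m (w x') ψ) x

/-- Von Mises formulation of the steady Prandtl equation with favorable pressure:
`w` is an Oleinik solution on `[0,X]` with structural constants `α, m, M, C₀, δ₁`. -/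
structure OleinikSolution (X : ℝ) (p : ℝ → ℝ) (w : ℝ → ℝ → ℝ)
    (α m M C₀ δ₁ : ℝ) : Prop where
  hX : 0 < X
  hp : ContDiff ℝ (⊤ : ℕ∞) p
  hfav : ∀ x : ℝ, deriv p x ≤ 0
  hα : α ∈ Set.Ioo (0 : ℝ) (1 / 2)
  hm : 0 < m
  hmM : m < M
  hC₀ : 0 < C₀
  hδ₁ : δ₁ ∈ Set.Ioo (0 : ℝ) 1
  cont : ContinuousOn (fun z : ℝ × ℝ => w z.1 z.2) (Set.Icc 0 X ×ˢ Set.Ici 0)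
  smooth : ContDiffOn ℝ (⊤ : ℕ∞) (fun z : ℝ × ℝ => w z.1 z.2) (Set.Ioc 0 X ×ˢ Set.Ioi 0)
  bdry : ∀ x ∈ Set.Icc (0 : ℝ) X, w x 0 = 0
  eqn : ∀ x ∈ Set.Ioc (0 : ℝ) X, ∀ ψ ∈ Set.Ioi (0 : ℝ),
    pd 1 0 w x ψ - Real.sqrt (w x ψ) * pd 0 2 w x ψ = -2 * deriv p x
  slope_lb : ∀ x ∈ Set.Icc (0 : ℝ) X, ∀ ψ ∈ Set.Icc (0 : ℝ) δ₁, m < pd 0 1 w x ψ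
  slope_ub : ∀ x ∈ Set.Icc (0 : ℝ) X, ∀ ψ ∈ Set.Icc (0 : ℝ) δ₁, pd 0 1 w x ψ < M
  growth_lb : ∀ x ∈ Set.Icc (0 : ℝ) X, ∀ ψ ∈ Set.Ioc (0 : ℝ) δ₁, m * ψ < w x ψ
  growth_ub : ∀ x ∈ Set.Icc (0 : ℝ) X, ∀ ψ ∈ Set.Ioc (0 : ℝ) δ₁, w x ψ < M * ψ
  dx_bound : ∀ x ∈ Set.Icc (0 : ℝ) X, ∀ ψ ∈ Set.Icc (0 : ℝ) δ₁,
    |pd 1 0 w x ψ| ≤ C₀ * ψ ^ ((1 : ℝ) / 2 + α)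

open Filter Topology

lemma aux_second (g g' : ℝ → ℝ) (y g2 : ℝ) (hmax : IsLocalMax g y)
    (hg : ∀ᶠ t in 𝓝 y, HasDerivAt g (g' t) t) (hg2 : HasDerivAt g' g2 y) : g2 ≤ 0 := by
  by_contra hcon
  push Not at hcon
  have e : deriv g =ᶠ[𝓝 y] g' := hg.mono fun t ht => ht.deriv
  have hd2 : deriv (deriv g) y = g2 := by rw [e.deriv_eq]; exact hg2.deriv
  have hmin : IsLocalMin g y :=
    isLocalMin_of_deriv_deriv_pos (by rw [hd2]; exact hcon) hmax.deriv_eq_zero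
      hg.self_of_nhds.continuousAt
  have hconst : g =ᶠ[𝓝 y] fun _ => g y := by
    filter_upwards [hmax, hmin] with t h1 h2
    exact le_antisymm h1 h2
  have h0 : deriv g =ᶠ[𝓝 y] fun _ => 0 := by
    refine hconst.deriv.trans ?_
    simp
  rw [h0.deriv_eq] at hd2
  simp at hd2
  linarith

lemma aux_left (g : ℝ → ℝ) (a b g1 : ℝ) (hab : a < b) (hmax : ∀ t ∈ Set.Icc a b, g t ≤ g b)
    (hg : HasDerivAt g g1 b) : 0 ≤ g1 := by
  have h := hg.hasDerivWithinAt (s := Set.Iio b)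
  rw [hasDerivWithinAt_iff_tendsto_slope' (by simp)] at h
  refine ge_of_tendsto h ?_
  filter_upwards [Ioo_mem_nhdsLT hab] with t ht
  rw [slope_def_field]
  apply div_nonneg_of_nonpos
  · linarith [hmax t ⟨ht.1.le, ht.2.le⟩]
  · linarith [ht.2]

lemma aux_maxpr (G : ℝ → ℝ → ℝ) (a b d : ℝ) (hab : a ≤ b) (hd : 0 < d)
    (hc : ContinuousOn (fun z : ℝ × ℝ => G z.1 z.2) (Set.Icc a b ×ˢ Set.Icc 0 d))
    (h1 : ∀ y ∈ Set.Icc 0 d, G a y ≤ 0) (h2 : ∀ x ∈ Set.Icc a b, G x 0 ≤ 0)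
    (h3 : ∀ x ∈ Set.Icc a b, G x d ≤ 0)
    (H : ∀ x ∈ Set.Ioc a b, ∀ y ∈ Set.Ioo 0 d, 0 < G x y → ∃ (G1 G2 s : ℝ) (G' : ℝ → ℝ),
      HasDerivAt (fun t => G t y) G1 x ∧ (∀ᶠ t in 𝓝 y, HasDerivAt (G x) (G' t) t) ∧
      HasDerivAt G' G2 y ∧ 0 ≤ s ∧ G1 - s * G2 < 0) :
    ∀ x ∈ Set.Icc a b, ∀ y ∈ Set.Icc 0 d, G x y ≤ 0 := by
  intro x hx y hy
  by_contra hcon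
  push Not at hcon
  obtain ⟨⟨u, v⟩, ⟨hu, hv⟩, hm⟩ := (isCompact_Icc.prod isCompact_Icc).exists_isMaxOn
    ⟨(x, y), hx, hy⟩ hc
  rw [isMaxOn_iff] at hm
  simp only at hu hv hm
  have hpos : 0 < G u v := lt_of_lt_of_le hcon (hm (x, y) ⟨hx, hy⟩)
  have hua : a < u := by
    rcases hu.1.lt_or_eq with h | h
    · exact h
    · subst h; linarith [h1 v hv]
  have hv0 : 0 < v := by
    rcases hv.1.lt_or_eq with h | h
    · exact h
    · subst h; linarith [h2 u hu]
  have hvd : v < d := by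
    rcases hv.2.lt_or_eq with h | h
    · exact h
    · subst h; linarith [h3 u hu]
  obtain ⟨G1, G2, s, G', d1, d2, d3, hs, hlt⟩ := H u ⟨hua, hu.2⟩ v ⟨hv0, hvd⟩ hpos
  have k1 : 0 ≤ G1 := aux_left _ a u G1 hua
    (fun t ht => hm (t, v) ⟨⟨ht.1, ht.2.trans hu.2⟩, hv⟩) d1
  have k2 : G2 ≤ 0 := by
    refine aux_second (G u) G' v G2 ?_ d2 d3
    filter_upwards [Icc_mem_nhds hv0 hvd] with t ht
    exact hm (u, t) ⟨hu, ht⟩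
  nlinarith

/-- directional derivative within a set -/
noncomputable def Dv (S : Set (ℝ × ℝ)) (v : ℝ × ℝ) (g : ℝ × ℝ → ℝ) (z : ℝ × ℝ) : ℝ :=
  fderivWithin ℝ g S z v

lemma Dv_smooth {S : Set (ℝ × ℝ)} (hS : UniqueDiffOn ℝ S) (v : ℝ × ℝ) {g : ℝ × ℝ → ℝ}
    (hg : ContDiffOn ℝ (⊤ : ℕ∞) g S) : ContDiffOn ℝ (⊤ : ℕ∞) (Dv S v g) S :=
  (hg.fderivWithin hS (m := (⊤ : ℕ∞)) (by simp)).clm_apply contDiffOn_const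

lemma Dv_comm {S : Set (ℝ × ℝ)} (hS : UniqueDiffOn ℝ S) (hSi : S ⊆ closure (interior S))
    (u v : ℝ × ℝ) {g : ℝ × ℝ → ℝ}
    (hg : ContDiffOn ℝ (⊤ : ℕ∞) g S) {z : ℝ × ℝ} (hz : z ∈ S) :
    Dv S u (Dv S v g) z = Dv S v (Dv S u g) z := by
  have hs : IsSymmSndFDerivWithinAt ℝ g S z :=
    (hg z hz).isSymmSndFDerivWithinAt (by simp only [minSmoothness_of_isRCLikeNormedField]; exact WithTop.coe_le_coe.2 (le_top (a := (2 : ℕ∞)))) hS (hSi hz) hz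
  have hd : DifferentiableWithinAt ℝ (fderivWithin ℝ g S) S z :=
    (hg.fderivWithin hS (m := (⊤ : ℕ∞)) (by simp)).differentiableOn (by simp) z hz
  have key : ∀ u v : ℝ × ℝ,
      Dv S u (Dv S v g) z = fderivWithin ℝ (fderivWithin ℝ g S) S z u v := by
    intro u v
    unfold Dv
    rw [fderivWithin_clm_apply (hS z hz) hd (differentiableWithinAt_const _)]
    simp
  rw [key, key]
  exact hs u v

lemma Dv_y {X : ℝ} {g : ℝ × ℝ → ℝ}
    (hg : ContDiffOn ℝ (⊤ : ℕ∞) g (Set.Ioc 0 X ×ˢ Set.Ioi 0)) {x y : ℝ} (hx : x ∈ Set.Ioc 0 X)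
    (hy : 0 < y) :
    HasDerivAt (fun t => g (x, t)) (Dv (Set.Ioc 0 X ×ˢ Set.Ioi 0) (0, 1) g (x, y)) y := by
  have h1 : HasFDerivWithinAt g _ (Set.Ioc 0 X ×ˢ Set.Ioi 0) (x, y) :=
    (hg.differentiableOn (by simp) (x, y) ⟨hx, hy⟩).hasFDerivWithinAt
  have h2 : HasDerivWithinAt (fun t : ℝ => (x, t)) (0, 1) (Set.Ioi 0) y :=
    ((hasDerivAt_const y x).prodMk (hasDerivAt_id y)).hasDerivWithinAt
  exact (h1.comp_hasDerivWithinAt y h2 (fun t ht => ⟨hx, ht⟩)).hasDerivAt (Ioi_mem_nhds hy)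

lemma Dv_x {X : ℝ} {g : ℝ × ℝ → ℝ}
    (hg : ContDiffOn ℝ (⊤ : ℕ∞) g (Set.Ioc 0 X ×ˢ Set.Ioi 0)) {x y : ℝ} (hx : x ∈ Set.Ioo 0 X)
    (hy : 0 < y) :
    HasDerivAt (fun t => g (t, y)) (Dv (Set.Ioc 0 X ×ˢ Set.Ioi 0) (1, 0) g (x, y)) x := by
  have h1 : HasFDerivWithinAt g _ (Set.Ioc 0 X ×ˢ Set.Ioi 0) (x, y) :=
    (hg.differentiableOn (by simp) (x, y) ⟨⟨hx.1, hx.2.le⟩, hy⟩).hasFDerivWithinAt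
  have h2 : HasDerivWithinAt (fun t : ℝ => (t, y)) (1, 0) (Set.Ioo 0 X) x :=
    ((hasDerivAt_id x).prodMk (hasDerivAt_const x y)).hasDerivWithinAt
  exact (h1.comp_hasDerivWithinAt x h2 (fun t (ht : t ∈ Set.Ioo 0 X) => (⟨⟨ht.1, ht.2.le⟩, hy⟩ : (t, y) ∈ Set.Ioc 0 X ×ˢ Set.Ioi 0))).hasDerivAt
    (Ioo_mem_nhds hx.1 hx.2)

lemma S_unique {X : ℝ} (hX : 0 < X) : UniqueDiffOn ℝ (Set.Ioc 0 X ×ˢ Set.Ioi (0 : ℝ)) :=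
  (uniqueDiffOn_Ioc 0 X).prod (uniqueDiffOn_Ioi 0)

lemma S_clos {X : ℝ} (hX : 0 < X) : (Set.Ioc 0 X ×ˢ Set.Ioi (0 : ℝ)) ⊆
    closure (interior (Set.Ioc 0 X ×ˢ Set.Ioi (0 : ℝ))) := by
  rw [interior_prod_eq, closure_prod_eq, interior_Ioc, interior_Ioi, closure_Ioo hX.ne,
    closure_Ioi]
  exact Set.prod_mono Set.Ioc_subset_Icc_self Set.Ioi_subset_Ici_self

section
variable {X : ℝ} {p : ℝ → ℝ} {w : ℝ → ℝ → ℝ} {α m M C₀ δ₁ : ℝ}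

lemma pd02 (hw : OleinikSolution X p w α m M C₀ δ₁) {x y : ℝ} (hx : x ∈ Set.Ioc 0 X)
    (hy : 0 < y) :
    pd 0 2 w x y = Dv (Set.Ioc 0 X ×ˢ Set.Ioi 0) (0, 1)
      (Dv (Set.Ioc 0 X ×ˢ Set.Ioi 0) (0, 1) (fun z => w z.1 z.2)) (x, y) := by
  unfold pd
  rw [iteratedDeriv_zero, iteratedDeriv_succ, iteratedDeriv_one]
  have e : deriv (w x) =ᶠ[𝓝 y]
      fun t => Dv (Set.Ioc 0 X ×ˢ Set.Ioi 0) (0, 1) (fun z => w z.1 z.2) (x, t) := by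
    filter_upwards [Ioi_mem_nhds hy] with t ht
    exact (Dv_y hw.smooth hx ht).deriv
  rw [e.deriv_eq]
  exact (Dv_y (Dv_smooth (S_unique hw.hX) (0, 1) hw.smooth) hx hy).deriv

lemma pd10 (hw : OleinikSolution X p w α m M C₀ δ₁) {x y : ℝ} (hx : x ∈ Set.Ioo 0 X)
    (hy : 0 < y) :
    pd 1 0 w x y = Dv (Set.Ioc 0 X ×ˢ Set.Ioi 0) (1, 0) (fun z => w z.1 z.2) (x, y) := by
  unfold pd
  simp only [iteratedDeriv_zero, iteratedDeriv_one]
  exact (Dv_x hw.smooth hx hy).deriv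

/-- the differentiated equation -/
lemma f_eq (hw : OleinikSolution X p w α m M C₀ δ₁) {x y : ℝ} (hx : x ∈ Set.Ioo 0 X)
    (hy : y ∈ Set.Ioc 0 δ₁) :
    ∃ (f1 f2 : ℝ) (f' : ℝ → ℝ), HasDerivAt (fun t => pd 1 0 w t y) f1 x ∧
      (∀ᶠ t in 𝓝 y, HasDerivAt (pd 1 0 w x) (f' t) t) ∧ HasDerivAt f' f2 y ∧
      f1 - Real.sqrt (w x y) * f2 = pd 1 0 w x y * (pd 1 0 w x y + 2 * deriv p x) / (2 * w x y)
        - 2 * deriv (deriv p) x := by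
  set S := Set.Ioc 0 X ×ˢ Set.Ioi (0 : ℝ) with hS
  set W : ℝ × ℝ → ℝ := fun z => w z.1 z.2 with hW
  have hU := S_unique hw.hX
  have hy0 : 0 < y := hy.1
  have hx' : x ∈ Set.Ioc 0 X := ⟨hx.1, hx.2.le⟩
  have sW : ContDiffOn ℝ (⊤ : ℕ∞) W S := hw.smooth
  have sf := Dv_smooth hU (1, 0) sW
  have sfy := Dv_smooth hU (0, 1) sf
  have sy := Dv_smooth hU (0, 1) sW
  have syy := Dv_smooth hU (0, 1) sy
  have hz : (x, y) ∈ S := ⟨hx', hy0⟩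
  have hcomm : Dv S (1, 0) (Dv S (0, 1) (Dv S (0, 1) W)) (x, y)
      = Dv S (0, 1) (Dv S (0, 1) (Dv S (1, 0) W)) (x, y) := by
    rw [Dv_comm hU (S_clos hw.hX) _ _ sy hz]
    have : ∀ z ∈ S, Dv S (1, 0) (Dv S (0, 1) W) z = Dv S (0, 1) (Dv S (1, 0) W) z :=
      fun z hz => Dv_comm hU (S_clos hw.hX) _ _ sW hz
    unfold Dv at this ⊢
    rw [fderivWithin_congr this (this _ hz)]
  have wpos : 0 < w x y :=
    lt_trans (mul_pos hw.hm hy0) (hw.growth_lb x ⟨hx'.1.le, hx'.2⟩ y hy)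
  have dW : HasDerivAt (fun t => w t y) (pd 1 0 w x y) x := by
    rw [pd10 hw hx hy0]; exact Dv_x sW hx hy0
  have dh := Dv_x syy hx hy0
  have dp : HasDerivAt (deriv p) (deriv (deriv p) x) x := by
    have : ContDiff ℝ (⊤ : ℕ∞) (deriv p) := by
      exact (contDiff_infty_iff_deriv.1 hw.hp).2
    exact (this.differentiable (by simp) x).hasDerivAt
  have dq := ((dW.sqrt wpos.ne').mul dh).sub (dp.const_mul 2)
  have e : (fun t => pd 1 0 w t y) =ᶠ[𝓝 x] fun t => Real.sqrt (w t y) *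
      Dv S (0, 1) (Dv S (0, 1) W) (t, y) - 2 * deriv p t := by
    filter_upwards [Ioo_mem_nhds hx.1 hx.2] with t ht
    have := hw.eqn t ⟨ht.1, ht.2.le⟩ y hy0
    rw [pd02 hw ⟨ht.1, ht.2.le⟩ hy0] at this
    linarith
  refine ⟨_, Dv S (0, 1) (Dv S (0, 1) (Dv S (1, 0) W)) (x, y),
    fun t => Dv S (0, 1) (Dv S (1, 0) W) (x, t), dq.congr_of_eventuallyEq e, ?_,
    Dv_y sfy hx' hy0, ?_⟩
  · filter_upwards [Ioi_mem_nhds hy0] with t ht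
    refine (Dv_y sf hx' ht).congr_of_eventuallyEq ?_
    filter_upwards [Ioi_mem_nhds ht] with r hr
    exact pd10 hw hx hr
  · rw [hcomm]
    have e0 := e.self_of_nhds
    simp only at e0
    set h := Dv S (0, 1) (Dv S (0, 1) W) (x, y)
    set f := pd 1 0 w x y
    have hsq : Real.sqrt (w x y) ^ 2 = w x y := Real.sq_sqrt wpos.le
    have hsp := Real.sqrt_pos.2 wpos
    set r := Real.sqrt (w x y)
    have : f + 2 * deriv p x = r * h := by linarith
    rw [this, ← hsq]
    field_simp
    ring

lemma f_cont (hw : OleinikSolution X p w α m M C₀ δ₁) {a b : ℝ} (ha : 0 < a) (hb : b < X) :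
    ContinuousOn (fun z : ℝ × ℝ => pd 1 0 w z.1 z.2) (Set.Icc a b ×ˢ Set.Icc 0 δ₁) := by
  have hα := hw.hα.1
  rintro ⟨x, y⟩ ⟨hx, hy⟩
  simp only at hx hy
  have hx' : x ∈ Set.Ioo 0 X := ⟨ha.trans_le hx.1, hx.2.trans_lt hb⟩
  rcases hy.1.lt_or_eq with h | h
  · apply ContinuousAt.continuousWithinAt
    have sf := (Dv_smooth (S_unique hw.hX) (1, 0) hw.smooth).continuousOn
    have hn : Set.Ioo 0 X ×ˢ Set.Ioi (0 : ℝ) ∈ 𝓝 (x, y) :=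
      prod_mem_nhds (Ioo_mem_nhds hx'.1 hx'.2) (Ioi_mem_nhds h)
    have := sf.continuousAt (x := (x, y))
      (Filter.mem_of_superset hn (Set.prod_mono Set.Ioo_subset_Ioc_self subset_rfl))
    refine this.congr ?_
    filter_upwards [hn] with z hz
    exact (pd10 hw hz.1 hz.2).symm
  · subst h
    have b0 : pd 1 0 w x 0 = 0 := by
      have := hw.dx_bound x ⟨hx'.1.le, hx'.2.le⟩ 0 hy
      rw [Real.zero_rpow (by positivity), mul_zero] at this
      exact abs_eq_zero.1 (le_antisymm this (abs_nonneg _))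
    unfold ContinuousWithinAt
    simp only [b0]
    refine squeeze_zero_norm' (a := fun z : ℝ × ℝ => C₀ * z.2 ^ ((1 : ℝ) / 2 + α)) ?_ ?_
    · filter_upwards [self_mem_nhdsWithin] with z hz
      exact hw.dx_bound z.1 ⟨(ha.trans_le hz.1.1).le, (hz.1.2.trans_lt hb).le⟩ z.2 hz.2
    · have : Continuous fun z : ℝ × ℝ => C₀ * z.2 ^ ((1 : ℝ) / 2 + α) :=
        continuous_const.mul (continuous_snd.rpow_const (fun _ => Or.inr (by positivity)))
      have h := this.tendsto (x, 0)
      simp only at h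
      rw [Real.zero_rpow (by positivity), mul_zero] at h
      exact h.mono_left nhdsWithin_le_nhds

lemma phi_d1 (A B : ℝ) {y : ℝ} (hy : 0 < y) :
    HasDerivAt (fun t => A * t - B * (t * Real.sqrt t)) (A - B * (3 / 2 * Real.sqrt y)) y := by
  have h := ((hasDerivAt_id y).const_mul A).sub
    (((hasDerivAt_id y).mul (Real.hasDerivAt_sqrt hy.ne')).const_mul B)
  refine h.congr_deriv ?_
  have hs := Real.sqrt_pos.2 hy
  have : y = Real.sqrt y ^ 2 := (Real.sq_sqrt hy.le).symm
  simp only [id]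
  have e : y * (1 / (2 * Real.sqrt y)) = Real.sqrt y / 2 := by
    field_simp; linarith
  rw [e]; ring

lemma phi_d2 (A B : ℝ) {y : ℝ} (hy : 0 < y) :
    HasDerivAt (fun t => A - B * (3 / 2 * Real.sqrt t)) (- (3 / 4 * B / Real.sqrt y)) y := by
  have h := (((Real.hasDerivAt_sqrt hy.ne').const_mul (3 / 2)).const_mul B).const_sub A
  refine h.congr_deriv ?_
  have hs := Real.sqrt_pos.2 hy
  field_simp
  norm_num

lemma f_small (hw : OleinikSolution X p w α m M C₀ δ₁) {x y : ℝ} (hx : x ∈ Set.Icc 0 X)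
    (hy : y ∈ Set.Ioc 0 δ₁) :
    |pd 1 0 w x y| ≤ C₀ ∧ pd 1 0 w x y ^ 2 / (2 * w x y) ≤ C₀ ^ 2 / (2 * m) := by
  have hα := hw.hα.1
  have hm := hw.hm
  have hC := hw.hC₀
  have hy0 : 0 < y := hy.1
  have hy1 : y ≤ 1 := hy.2.trans hw.hδ₁.2.le
  have hb := hw.dx_bound x hx y ⟨hy.1.le, hy.2⟩
  have k1 : y ^ ((1 : ℝ) / 2 + α) ≤ Real.sqrt y := by
    rw [Real.sqrt_eq_rpow]
    exact Real.rpow_le_rpow_of_exponent_ge hy0 hy1 (by linarith)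
  have k2 : Real.sqrt y ≤ 1 := Real.sqrt_le_one.2 hy1
  have k3 : |pd 1 0 w x y| ≤ C₀ * Real.sqrt y := hb.trans (by gcongr)
  refine ⟨k3.trans (by nlinarith), ?_⟩
  have k4 : pd 1 0 w x y ^ 2 ≤ C₀ ^ 2 * y := by
    rw [← sq_abs]
    calc |pd 1 0 w x y| ^ 2 ≤ (C₀ * Real.sqrt y) ^ 2 := by gcongr
      _ = C₀ ^ 2 * y := by rw [mul_pow, Real.sq_sqrt hy0.le]
  have hl := hw.growth_lb x hx y hy
  have : 0 < m * y := by positivity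
  calc pd 1 0 w x y ^ 2 / (2 * w x y) ≤ (C₀ ^ 2 * y) / (2 * (m * y)) := by gcongr
    _ = C₀ ^ 2 / (2 * m) := by field_simp

lemma barrier (hw : OleinikSolution X p w α m M C₀ δ₁) {a b A B P s : ℝ} (ha : 0 < a)
    (hab : a ≤ b) (hb : b < X) (hs : |s| = 1)
    (hP : ∀ x ∈ Set.Icc 0 X, |deriv (deriv p) x| ≤ P) (hB : 0 ≤ B)
    (hBK : C₀ + X * (C₀ ^ 2 / (2 * m) + 2 * P) < 3 / 4 * B * Real.sqrt m)
    (hA : X * C₀ ≤ δ₁ * (A - B)) (hAB : B ≤ A) :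
    ∀ x ∈ Set.Icc a b, ∀ y ∈ Set.Icc 0 δ₁,
      s * (x - a) * pd 1 0 w x y - (A * y - B * (y * Real.sqrt y)) ≤ 0 := by
  have hX := hw.hX
  have hm := hw.hm
  have hC := hw.hC₀
  have hα := hw.hα.1
  have hd0 := hw.hδ₁.1
  have hd1 := hw.hδ₁.2
  have phi : ∀ y ∈ Set.Icc 0 δ₁, y * (A - B) ≤ A * y - B * (y * Real.sqrt y) := by
    intro y hy
    have k2 : Real.sqrt y ≤ 1 := Real.sqrt_le_one.2 (hy.2.trans hd1.le)
    have : B * (y * Real.sqrt y) ≤ B * (y * 1) := by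
      have := hy.1
      gcongr
    linarith
  have phi0 : ∀ y ∈ Set.Icc 0 δ₁, 0 ≤ A * y - B * (y * Real.sqrt y) := fun y hy =>
    le_trans (mul_nonneg hy.1 (by linarith)) (phi y hy)
  refine aux_maxpr (fun x y => s * (x - a) * pd 1 0 w x y - (A * y - B * (y * Real.sqrt y)))
    a b δ₁ hab hd0 ?_ ?_ ?_ ?_ ?_
  · refine ContinuousOn.sub (ContinuousOn.mul (by fun_prop) (f_cont hw ha hb)) ?_
    fun_prop
  · intro y hy
    simpa using phi0 y hy
  · intro x hx
    have := hw.dx_bound x ⟨(ha.trans_le hx.1).le, (hx.2.trans_lt hb).le⟩ 0 ⟨le_rfl, hd0.le⟩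
    rw [Real.zero_rpow (by positivity), mul_zero] at this
    have := abs_eq_zero.1 (le_antisymm this (abs_nonneg _))
    simp [this]
  · intro x hx
    have h1 := (f_small hw ⟨(ha.trans_le hx.1).le, (hx.2.trans_lt hb).le⟩
      (y := δ₁) ⟨hd0, le_rfl⟩).1
    have h2 := phi δ₁ ⟨hd0.le, le_rfl⟩
    have h3 : s * (x - a) * pd 1 0 w x δ₁ ≤ X * C₀ := by
      refine (le_abs_self _).trans ?_
      rw [abs_mul, abs_mul, hs, one_mul, abs_of_nonneg (by linarith [hx.1])]
      have : x - a ≤ X := by linarith [hx.2]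
      gcongr
    linarith
  · intro x hx y hy hpos
    have hxI : x ∈ Set.Ioo 0 X := ⟨ha.trans hx.1, hx.2.trans_lt hb⟩
    have hxc : x ∈ Set.Icc 0 X := ⟨hxI.1.le, hxI.2.le⟩
    have hyI : y ∈ Set.Ioc 0 δ₁ := ⟨hy.1, hy.2.le⟩
    have hy0 : 0 < y := hy.1
    obtain ⟨f1, f2, f', d1, d2, d3, E⟩ := f_eq hw hxI hyI
    obtain ⟨b1, b2⟩ := f_small hw hxc hyI
    have hl := hw.growth_lb x hxc y hyI
    have hmy : 0 < m * y := by positivity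
    have wpos : 0 < w x y := hmy.trans hl
    have hph := phi0 y ⟨hy.1.le, hy.2.le⟩
    have bp := hP x hxc
    have hfav := hw.hfav x
    refine ⟨s * pd 1 0 w x y + s * (x - a) * f1, s * (x - a) * f2 + 3 / 4 * B / Real.sqrt y,
      Real.sqrt (w x y), fun t => s * (x - a) * f' t - (A - B * (3 / 2 * Real.sqrt t)),
      ?_, ?_, ?_, Real.sqrt_nonneg _, ?_⟩
    · have := ((((hasDerivAt_id x).sub_const a).const_mul s).mul d1).sub_const
        (A * y - B * (y * Real.sqrt y))
      refine this.congr_deriv ?_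
      simp
    · filter_upwards [d2, Ioi_mem_nhds hy0] with t h1 h2
      exact (h1.const_mul _).sub (phi_d1 A B h2)
    · refine ((d3.const_mul _).sub (phi_d2 A B hy0)).congr_deriv ?_
      ring
    · set f := pd 1 0 w x y
      set W := w x y
      have hsy := Real.sqrt_pos.2 hy0
      have q1 : Real.sqrt m ≤ Real.sqrt W / Real.sqrt y := by
        rw [le_div_iff₀ hsy, ← Real.sqrt_mul hm.le]
        exact Real.sqrt_le_sqrt hl.le
      have q2 : 3 / 4 * B * Real.sqrt m ≤ 3 / 4 * B * (Real.sqrt W / Real.sqrt y) := by gcongr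
      have q3 : s * (x - a) * f * (deriv p x / W) ≤ 0 :=
        mul_nonpos_of_nonneg_of_nonpos (by linarith)
          (div_nonpos_of_nonpos_of_nonneg hfav wpos.le)
      have q4 : s * f ≤ C₀ := by
        refine (le_abs_self _).trans ?_
        rw [abs_mul, hs, one_mul]; exact b1
      have q5 : s * (x - a) * (f ^ 2 / (2 * W) - 2 * deriv (deriv p) x)
          ≤ X * (C₀ ^ 2 / (2 * m) + 2 * P) := by
        refine (le_abs_self _).trans ?_
        rw [abs_mul, abs_mul, hs, one_mul, abs_of_nonneg (by linarith [hx.1])]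
        have : x - a ≤ X := by linarith [hxI.2]
        have : |f ^ 2 / (2 * W) - 2 * deriv (deriv p) x| ≤ C₀ ^ 2 / (2 * m) + 2 * P := by
          refine (abs_sub _ _).trans ?_
          rw [abs_of_nonneg (by positivity : 0 ≤ f ^ 2 / (2 * W)), abs_mul, abs_two]
          linarith
        gcongr
      have q6 : f1 - Real.sqrt W * f2 = (f ^ 2 / (2 * W) - 2 * deriv (deriv p) x)
          + f * (deriv p x / W) := by
        rw [E]; field_simp; ring
      have q7 : s * f + s * (x - a) * f1
            - Real.sqrt W * (s * (x - a) * f2 + 3 / 4 * B / Real.sqrt y)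
          = s * f + s * (x - a) * (f1 - Real.sqrt W * f2)
            - 3 / 4 * B * (Real.sqrt W / Real.sqrt y) := by ring
      rw [q7, q6]
      linarith
end

/-- Improved growth estimate for `∂ₓ w`: for any `0 < ε < X` there exist
`δ ∈ (0, δ₁]` and `C > 0` such that `|∂ₓ w(x,ψ)| ≤ C ψ` on `[ε,X] × [0,δ]`. -/
theorem dx_linear_growth (X : ℝ) (p : ℝ → ℝ) (w : ℝ → ℝ → ℝ) (α m M C₀ δ₁ : ℝ)
    (hw : OleinikSolution X p w α m M C₀ δ₁)
    (ε : ℝ) (hε : 0 < ε) (hεX : ε < X) :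
    ∃ δ ∈ Set.Ioc (0 : ℝ) δ₁, ∃ C > 0,
      ∀ x ∈ Set.Icc ε X, ∀ ψ ∈ Set.Icc (0 : ℝ) δ,
        |pd 1 0 w x ψ| ≤ C * ψ := by
  have hX := hw.hX
  have hm := hw.hm
  have hC := hw.hC₀
  have hα := hw.hα.1
  have hd0 := hw.hδ₁.1
  have hpc : ContDiff ℝ (⊤ : ℕ∞) (deriv p) := (contDiff_infty_iff_deriv.1 hw.hp).2
  have hpcc : Continuous (deriv (deriv p)) := (contDiff_infty_iff_deriv.1 hpc).2.continuous
  obtain ⟨P, hP⟩ := (isCompact_Icc (a := (0 : ℝ)) (b := X)).exists_bound_of_continuousOn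
    hpcc.continuousOn
  simp only [Real.norm_eq_abs] at hP
  have hP0 : 0 ≤ P := (abs_nonneg _).trans (hP 0 ⟨le_rfl, hX.le⟩)
  have hsm := Real.sqrt_pos.2 hm
  set K := C₀ + X * (C₀ ^ 2 / (2 * m) + 2 * P) with hK
  have hK0 : 0 < K := by positivity
  obtain ⟨B, hBdef⟩ : ∃ B, B = 2 * K / Real.sqrt m := ⟨_, rfl⟩
  have hB : 0 < B := by rw [hBdef]; positivity
  have hBK : K < 3 / 4 * B * Real.sqrt m := by
    have : 3 / 4 * B * Real.sqrt m = 3 / 2 * K := by rw [hBdef]; field_simp; norm_num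
    linarith
  obtain ⟨A, hAdef⟩ : ∃ A, A = B + X * C₀ / δ₁ := ⟨_, rfl⟩
  have hAB : B ≤ A := by
    have : 0 < X * C₀ / δ₁ := by positivity
    linarith
  have hA : X * C₀ ≤ δ₁ * (A - B) := by
    rw [hAdef]; apply le_of_eq; field_simp; ring
  have hA0 : 0 < A := hB.trans_le hAB
  have main : ∀ x ∈ Set.Ico ε X, ∀ y ∈ Set.Icc (0 : ℝ) δ₁,
      |pd 1 0 w x y| ≤ 2 * A / ε * y := by
    intro x hx y hy
    have hh : ∀ s : ℝ, |s| = 1 → s * (x - ε / 2) * pd 1 0 w x y ≤ A * y := by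
      intro s hs
      have := barrier hw (half_pos hε) (by linarith [hx.1] : ε / 2 ≤ x) hx.2 hs hP hB.le hBK
        hA hAB x ⟨by linarith [hx.1], le_rfl⟩ y hy
      have h0 : 0 ≤ B * (y * Real.sqrt y) :=
        mul_nonneg hB.le (mul_nonneg hy.1 (Real.sqrt_nonneg _))
      linarith
    have h1 := hh 1 (by simp)
    have h2 := hh (-1) (by simp)
    have h3 : (x - ε / 2) * |pd 1 0 w x y| ≤ A * y := by
      rcases abs_cases (pd 1 0 w x y) with h | h <;> rw [h.1] <;> linarith
    have h4 : ε / 2 * |pd 1 0 w x y| ≤ (x - ε / 2) * |pd 1 0 w x y| := by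
      have : ε / 2 ≤ x - ε / 2 := by linarith [hx.1]
      gcongr
    rw [div_mul_eq_mul_div, le_div_iff₀ hε]
    linarith
  refine ⟨δ₁, ⟨hd0, le_rfl⟩, 2 * A / ε, by positivity, ?_⟩
  intro x hx y hy
  rcases hx.2.lt_or_eq with h | h
  · exact main x ⟨hx.1, h⟩ y hy
  subst h
  rcases hy.1.lt_or_eq with hy0 | hy0
  swap
  · subst hy0
    have := hw.dx_bound x ⟨hX.le, le_rfl⟩ 0 hy
    rw [Real.zero_rpow (by positivity), mul_zero] at this
    simpa using this
  set S := Set.Ioc 0 x ×ˢ Set.Ioi (0 : ℝ) with hS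
  have syy := (Dv_smooth (S_unique hX) (0, 1)
    (Dv_smooth (S_unique hX) (0, 1) hw.smooth)).continuousOn
  set q : ℝ → ℝ := fun t => Real.sqrt (w t y) *
    Dv S (0, 1) (Dv S (0, 1) (fun z => w z.1 z.2)) (t, y) - 2 * deriv p t with hq
  have heq : ∀ t ∈ Set.Ioc 0 x, pd 1 0 w t y = q t := by
    intro t ht
    have := hw.eqn t ht y hy0
    rw [pd02 hw ht hy0] at this
    simp only [hq]
    linarith
  have hmap : Set.MapsTo (fun t : ℝ => (t, y)) (Set.Ioc 0 x) S := fun t ht => ⟨ht, hy0⟩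
  have c1 : ContinuousOn (fun t => w t y) (Set.Ioc 0 x) :=
    hw.smooth.continuousOn.comp (f := fun t : ℝ => (t, y)) (by fun_prop) hmap
  have c2 : ContinuousOn
      (fun t => Dv S (0, 1) (Dv S (0, 1) (fun z => w z.1 z.2)) (t, y)) (Set.Ioc 0 x) :=
    syy.comp (f := fun t : ℝ => (t, y)) (by fun_prop) hmap
  have cq : ContinuousOn q (Set.Ioc 0 x) :=
    (c1.sqrt.mul c2).sub (continuousOn_const.mul hpc.continuous.continuousOn)
  have ct : Tendsto q (𝓝[<] x) (𝓝 (q x)) := by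
    have := cq x ⟨hX, le_rfl⟩
    refine this.mono_left ?_
    rw [← nhdsWithin_Ioo_eq_nhdsLT hX]
    exact nhdsWithin_mono _ Set.Ioo_subset_Ioc_self
  rw [heq x ⟨hX, le_rfl⟩]
  refine le_of_tendsto ct.abs ?_
  filter_upwards [Ioo_mem_nhdsLT hεX] with t ht
  rw [← heq t ⟨hε.trans ht.1, ht.2.le⟩]
  exact main t ⟨ht.1.le, ht.2⟩ y hy
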